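/- Let A be a real 3×3 matrix and b, c ∈ ℝ³ with the pair (A,b) controllable, i.e. b, Ab, A²b are linearly independent. Let u : [0,∞) → [0,1] be measurable and let l be a locally absolutely continuous solution of l'(t) = −Aᵀl(t) − u(t)·c·(bᵀl(t)) for almost every t ≥ 0, with l(0) ≠ 0, and set φ_b(t) := bᵀl(t). If φ_b(t̄) = 0 at some t̄ ≥ 0, then φ_b is differentiable at t̄ with φ_b'(t̄) = −bᵀAᵀl(t̄), and: (a) if φ_b'(t̄) ≠ 0, there exists ε > 0 such that φ_b is nonzero on ((t̄−ε, t̄+ε) ∩ [0,∞)) \ {t̄} and has opposite strict signs on (t̄−ε, t̄) ∩ [0,∞) and on (t̄, t̄+ε); (b) if φ_b'(t̄) = 0, then φ_b is twice differentiable at t̄ with φ_b''(t̄) = bᵀ(Aᵀ)²l(t̄) ≠ 0, and there exists ε > 0 such that φ_b is nonzero with the same strict sign on ((t̄−ε, t̄+ε) ∩ [0,∞)) \ {t̄}. In particular, the zeros of φ_b are isolated. -/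

import Mathlib

open MeasureTheory Filter Topology Matrix

noncomputable section

theorem isLittleO_integral_sub_pow {p : ℝ → ℝ} {S : Set ℝ} (hS : S.OrdConnected) {a κ : ℝ}
    (ha : a ∈ S) (n : ℕ) (hp : ∀ t ∈ S, IntervalIntegrable p volume a t)
    (h : (fun s => p s - κ * (s - a) ^ n) =o[𝓝[S] a] fun s => (s - a) ^ n) :
    (fun t => (∫ s in a..t, p s) - κ * ((t - a) ^ (n + 1) / (n + 1))) =o[𝓝[S] a]
      fun t => (t - a) ^ (n + 1) := by
  rw [Asymptotics.isLittleO_iff] at h ⊢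
  intro ε hε
  obtain ⟨δ, hδ, hb⟩ := Metric.mem_nhdsWithin_iff.1 (h hε)
  filter_upwards [self_mem_nhdsWithin, inter_mem_nhdsWithin S (Metric.ball_mem_nhds a hδ)]
    with t htS ht
  have htδ : |t - a| < δ := by simpa [Real.dist_eq] using ht.2
  have hint : ∫ s in a..t, κ * (s - a) ^ n = κ * ((t - a) ^ (n + 1) / (n + 1)) := by
    rw [intervalIntegral.integral_const_mul,
      intervalIntegral.integral_comp_sub_right (fun s => s ^ n), integral_pow]
    simp
  rw [← hint, ← intervalIntegral.integral_sub (hp t htS)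
    ((by fun_prop : Continuous fun s => κ * (s - a) ^ n).intervalIntegrable _ _)]
  refine (intervalIntegral.norm_integral_le_of_norm_le_const
    (C := ε * |t - a| ^ n) fun s hs => ?_).trans_eq ?_
  · have hs' : s ∈ Set.uIcc a t := Set.uIoc_subset_uIcc hs
    have hst : |s - a| ≤ |t - a| := Set.abs_sub_left_of_mem_uIcc hs'
    have := hb ⟨by simpa [Real.dist_eq] using hst.trans_lt htδ, hS.uIcc_subset ha htS hs'⟩
    simp only [Set.mem_ofPred_eq, norm_pow, Real.norm_eq_abs] at this
    refine this.trans ?_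
    gcongr
  · simp only [norm_pow, Real.norm_eq_abs]
    ring

theorem eq_zero_of_norm_le_integral {E : Type*} [NormedAddCommGroup E]
    {x : ℝ → E} {T K : ℝ} (hT : 0 ≤ T) (hx : Continuous x)
    (h : ∀ t ∈ Set.Icc 0 T, ‖x t‖ ≤ K * ∫ s in (0:ℝ)..t, ‖x s‖) : x T = 0 := by
  have hd : ∀ t, HasDerivAt (fun t => ∫ s in (0:ℝ)..t, ‖x s‖) ‖x t‖ t := fun t =>
    (hx.norm.integral_hasStrictDerivAt 0 t).hasDerivAt
  have key := norm_le_gronwallBound_of_norm_deriv_right_le (δ := 0) (K := K) (ε := 0)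
    (a := 0) (b := T) (fun t _ => (hd t).continuousAt.continuousWithinAt)
    (fun t _ => (hd t).hasDerivWithinAt) (by simp) (fun t ht => by
      have hn : 0 ≤ ∫ s in (0:ℝ)..t, ‖x s‖ :=
        intervalIntegral.integral_nonneg ht.1 fun _ _ => norm_nonneg _
      simpa [abs_of_nonneg hn] using h t ⟨ht.1, ht.2.le⟩) T ⟨hT, le_rfl⟩
  have h0 : ∫ s in (0:ℝ)..T, ‖x s‖ = 0 := by
    simpa [gronwallBound_ε0_δ0] using key
  simpa [h0] using h T ⟨hT, le_rfl⟩

theorem exists_pos_mul_of_tendsto {q : ℝ → ℝ} {S : Set ℝ} {a d : ℝ}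
    (h : Tendsto q (𝓝[S \ {a}] a) (𝓝 d)) (hd : d ≠ 0) :
    ∃ ε > (0:ℝ), ∀ s ∈ S, s ≠ a → |s - a| < ε → 0 < d * q s := by
  have h1 : ∀ᶠ s in 𝓝[S \ {a}] a, 0 < d * q s :=
    (h.const_mul d).eventually (lt_mem_nhds (mul_self_pos.2 hd))
  obtain ⟨ε, hε, hb⟩ := Metric.mem_nhdsWithin_iff.1 h1
  exact ⟨ε, hε, fun s hs hsa hsε => hb ⟨by simpa [Real.dist_eq] using hsε, hs, hsa⟩⟩

theorem dotProduct_intervalIntegral {ι : Type*} [Fintype ι] (v : ι → ℝ) {f : ℝ → ι → ℝ} {a b : ℝ}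
    (hf : IntervalIntegrable f volume a b) :
    v ⬝ᵥ (∫ s in a..b, f s) = ∫ s in a..b, v ⬝ᵥ f s := by
  have := (∑ i, v i • ContinuousLinearMap.proj (R := ℝ) (φ := fun _ : ι => ℝ) i
    ).intervalIntegral_comp_comm hf
  simpa [dotProduct] using this.symm

theorem eq_zero_of_dotProduct_eq_zero {n : ℕ} {v : Fin n → Fin n → ℝ}
    (hv : LinearIndependent ℝ v) {x : Fin n → ℝ} (h : ∀ i, v i ⬝ᵥ x = 0) : x = 0 := by
  have hu : IsUnit (Matrix.of v) := Matrix.linearIndependent_rows_iff_isUnit.1 hv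
  refine Matrix.mulVec_injective_of_isUnit hu ?_
  ext i
  simpa [Matrix.mulVec] using h i

theorem stmt15 (A : Matrix (Fin 3) (Fin 3) ℝ) (b c : Fin 3 → ℝ)
    (hctrl : LinearIndependent ℝ ![b, A.mulVec b, A.mulVec (A.mulVec b)])
    (u : ℝ → ℝ) (hu : Measurable u) (hu1 : ∀ t, u t ∈ Set.Icc (0:ℝ) 1)
    (l : ℝ → Fin 3 → ℝ) (hlc : ContinuousOn l (Set.Ici 0))
    (hode : ∀ t ≥ (0:ℝ),
      l t = l 0 - ∫ s in (0:ℝ)..t, ((Aᵀ).mulVec (l s) + (u s * (b ⬝ᵥ l s)) • c))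
    (hl0 : l 0 ≠ 0) (tb : ℝ) (htb : 0 ≤ tb) (hzero : b ⬝ᵥ l tb = 0) :
    HasDerivWithinAt (fun t => b ⬝ᵥ l t) (-(b ⬝ᵥ (Aᵀ).mulVec (l tb))) (Set.Ici 0) tb ∧
    (-(b ⬝ᵥ (Aᵀ).mulVec (l tb)) ≠ 0 →
      ∃ ε > (0:ℝ),
        (∀ s, 0 ≤ s → tb - ε < s → s < tb →
          (-(b ⬝ᵥ (Aᵀ).mulVec (l tb))) * (b ⬝ᵥ l s) < 0) ∧
        (∀ s, tb < s → s < tb + ε →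
          0 < (-(b ⬝ᵥ (Aᵀ).mulVec (l tb))) * (b ⬝ᵥ l s))) ∧
    (-(b ⬝ᵥ (Aᵀ).mulVec (l tb)) = 0 →
      Tendsto (fun t => 2 * (b ⬝ᵥ l t) / (t - tb) ^ 2) (𝓝[Set.Ici 0 \ {tb}] tb)
        (𝓝 (b ⬝ᵥ (Aᵀ * Aᵀ).mulVec (l tb))) ∧
      b ⬝ᵥ (Aᵀ * Aᵀ).mulVec (l tb) ≠ 0 ∧
      ∃ ε > (0:ℝ), ∀ s, 0 ≤ s → s ≠ tb → |s - tb| < ε →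
        0 < (b ⬝ᵥ (Aᵀ * Aᵀ).mulVec (l tb)) * (b ⬝ᵥ l s)) ∧
    ∃ ε > (0:ℝ), ∀ s, 0 ≤ s → s ≠ tb → |s - tb| < ε → b ⬝ᵥ l s ≠ 0 := by
  have hL : Continuous fun t => l (max t 0) :=
    hlc.comp_continuous (by fun_prop) fun t => le_max_right t 0
  set L : ℝ → Fin 3 → ℝ := fun t => l (max t 0) with hLdef
  have hLl : ∀ t, 0 ≤ t → L t = l t := fun t ht => by simp [hLdef, ht]
  set f : ℝ → Fin 3 → ℝ := fun s => Aᵀ *ᵥ L s + (u s * (b ⬝ᵥ L s)) • c with hf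
  have hφc : Continuous fun s => b ⬝ᵥ L s := continuous_const.dotProduct hL
  have hAc : Continuous fun s => Aᵀ *ᵥ L s := continuous_const.matrix_mulVec hL
  have hui : ∀ a t, IntervalIntegrable (fun s => u s * (b ⬝ᵥ L s)) volume a t := fun a t => by
    rw [intervalIntegrable_iff]
    refine (hφc.intervalIntegrable a t).def'.bdd_mul (c := 1) hu.aestronglyMeasurable ?_
    exact Eventually.of_forall fun s => by
      rw [Real.norm_eq_abs, abs_of_nonneg (hu1 s).1]; exact (hu1 s).2
  have hfi : ∀ a t, IntervalIntegrable f volume a t := fun a t =>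
    (hAc.intervalIntegrable a t).add ⟨(hui a t).1.smul_const c, (hui a t).2.smul_const c⟩
  have hint : ∀ s t, 0 ≤ s → 0 ≤ t → L t = L s - ∫ r in s..t, f r := by
    have h0 : ∀ t, 0 ≤ t → L t = l 0 - ∫ r in (0:ℝ)..t, f r := fun t ht => by
      rw [hLl t ht, hode t ht]
      congr 1
      refine intervalIntegral.integral_congr fun r hr => ?_
      rw [Set.uIcc_of_le ht] at hr
      simp only [hf, hLl r hr.1]
    intro s t hs ht
    rw [h0 s hs, h0 t ht, ← intervalIntegral.integral_add_adjacent_intervals (hfi 0 s) (hfi s t)]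
    abel
  have hdot : ∀ v : Fin 3 → ℝ, ∀ t, 0 ≤ t →
      v ⬝ᵥ l t = v ⬝ᵥ l tb - ∫ s in tb..t, v ⬝ᵥ f s := fun v t ht => by
    rw [← hLl t ht, hint tb t htb ht, dotProduct_sub, dotProduct_intervalIntegral v (hfi _ _),
      hLl tb htb]
  have hdoti : ∀ v : Fin 3 → ℝ, ∀ t, IntervalIntegrable (fun s => v ⬝ᵥ f s) volume tb t := by
    intro v t
    have := (∑ i, v i • ContinuousLinearMap.proj (R := ℝ) (φ := fun _ : Fin 3 => ℝ) i
      ).integrable_comp (hfi tb t).def'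
    rw [intervalIntegrable_iff]
    simpa [dotProduct, IntegrableOn] using this
  have hLtb : L tb = l tb := hLl tb htb
  have huφ : ∀ {k : ℝ → ℝ} {F : Filter ℝ}, (fun s => b ⬝ᵥ L s) =o[F] k →
      (fun s => u s * (b ⬝ᵥ L s)) =o[F] k := fun {k F} h => by
    refine Asymptotics.IsBigO.trans_isLittleO (Asymptotics.IsBigO.of_bound 1 ?_) h
    refine Eventually.of_forall fun s => ?_
    rw [norm_mul, Real.norm_eq_abs (u s), abs_of_nonneg (hu1 s).1]
    exact mul_le_mul_of_nonneg_right (hu1 s).2 (norm_nonneg _)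
  have hvf : ∀ (v : Fin 3 → ℝ) s, v ⬝ᵥ f s = v ⬝ᵥ Aᵀ *ᵥ L s + (v ⬝ᵥ c) * (u s * (b ⬝ᵥ L s)) :=
    fun v s => by simp only [hf, dotProduct_add, dotProduct_smul, smul_eq_mul]; ring
  have hder : ∀ v : Fin 3 → ℝ, HasDerivWithinAt (fun t => v ⬝ᵥ l t)
      (-(v ⬝ᵥ Aᵀ *ᵥ l tb)) (Set.Ici 0) tb := by
    intro v
    have hφ1 : (fun s => b ⬝ᵥ L s) =o[𝓝[Set.Ici 0] tb] fun _ => (1:ℝ) := by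
      rw [Asymptotics.isLittleO_one_iff]
      have := hφc.tendsto tb
      rw [hLtb, hzero] at this
      exact this.mono_left nhdsWithin_le_nhds
    have hA1 : (fun s => v ⬝ᵥ Aᵀ *ᵥ L s - v ⬝ᵥ Aᵀ *ᵥ l tb) =o[𝓝[Set.Ici 0] tb]
        fun _ => (1:ℝ) := by
      rw [Asymptotics.isLittleO_one_iff]
      have := ((continuous_const (y := v)).dotProduct hAc).tendsto tb
      rw [hLtb] at this
      simpa using (this.mono_left nhdsWithin_le_nhds).sub_const (v ⬝ᵥ Aᵀ *ᵥ l tb)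
    have h := isLittleO_integral_sub_pow (p := fun s => v ⬝ᵥ f s) (κ := v ⬝ᵥ Aᵀ *ᵥ l tb)
      Set.ordConnected_Ici htb 0 (fun t _ => hdoti v t) (by
        simp only [pow_zero]
        refine (hA1.add ((huφ hφ1).const_mul_left (v ⬝ᵥ c))).congr_left fun s => ?_
        rw [hvf]; ring)
    rw [hasDerivWithinAt_iff_isLittleO]
    refine (h.neg_left.congr' ?_ ?_)
    · filter_upwards [self_mem_nhdsWithin] with t ht
      simp only [hdot v t ht, smul_eq_mul]
      simp
      ring
    · exact Eventually.of_forall fun t => by simp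
  have hAT : ∀ v x : Fin 3 → ℝ, v ⬝ᵥ Aᵀ *ᵥ x = (A *ᵥ v) ⬝ᵥ x := fun v x => by
    rw [dotProduct_mulVec, vecMul_transpose]
  have hltb : l tb ≠ 0 := by
    intro hz
    apply hl0
    set C := ‖LinearMap.toContinuousLinearMap (Matrix.mulVecLin Aᵀ)‖ with hC
    set B := ‖∑ i, b i • ContinuousLinearMap.proj (R := ℝ) (φ := fun _ : Fin 3 => ℝ) i‖ with hB
    have hfb : ∀ s, ‖f s‖ ≤ (C + B * ‖c‖) * ‖L s‖ := fun s => by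
      have h1 : ‖Aᵀ *ᵥ L s‖ ≤ C * ‖L s‖ :=
        (LinearMap.toContinuousLinearMap (Matrix.mulVecLin Aᵀ)).le_opNorm (L s)
      have h2 : ‖b ⬝ᵥ L s‖ ≤ B * ‖L s‖ := by
        simpa [dotProduct] using (∑ i, b i •
          ContinuousLinearMap.proj (R := ℝ) (φ := fun _ : Fin 3 => ℝ) i).le_opNorm (L s)
      have h3 : ‖u s * (b ⬝ᵥ L s)‖ ≤ B * ‖L s‖ := by
        rw [norm_mul, Real.norm_eq_abs (u s), abs_of_nonneg (hu1 s).1]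
        exact (mul_le_of_le_one_left (norm_nonneg _) (hu1 s).2).trans h2
      calc ‖f s‖ ≤ ‖Aᵀ *ᵥ L s‖ + ‖u s * (b ⬝ᵥ L s)‖ * ‖c‖ := by
            rw [← norm_smul]; exact norm_add_le _ _
        _ ≤ C * ‖L s‖ + (B * ‖L s‖) * ‖c‖ := by gcongr
        _ = _ := by ring
    have hres := eq_zero_of_norm_le_integral (x := fun r => L (tb - r)) (K := C + B * ‖c‖) htb
      (hL.comp (by fun_prop)) (fun t ht => by
        have ht0 : 0 ≤ tb - t := by linarith [ht.2]
        have hc := intervalIntegral.integral_comp_sub_left (a := 0) (b := t) (fun r => ‖L r‖) tb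
        rw [hc, sub_zero]
        show ‖L (tb - t)‖ ≤ _
        rw [hint tb _ htb ht0, hLtb, hz, zero_sub, norm_neg, intervalIntegral.integral_symm,
          norm_neg, ← intervalIntegral.integral_const_mul]
        exact intervalIntegral.norm_integral_le_of_norm_le (by linarith [ht.1])
          (Eventually.of_forall fun s _ => hfb s)
          ((continuous_const.mul hL.norm).intervalIntegrable _ _))
    simpa [hLdef] using hres
  have hb := hder b
  have parta : -(b ⬝ᵥ Aᵀ *ᵥ l tb) ≠ 0 → ∃ ε > (0:ℝ), ∀ s ∈ Set.Ici (0:ℝ), s ≠ tb → |s - tb| < ε →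
      0 < -(b ⬝ᵥ Aᵀ *ᵥ l tb) * slope (fun t => b ⬝ᵥ l t) tb s := fun hne =>
    exists_pos_mul_of_tendsto (hasDerivWithinAt_iff_tendsto_slope.1 hb) hne
  have partb : -(b ⬝ᵥ Aᵀ *ᵥ l tb) = 0 →
      Tendsto (fun t => 2 * (b ⬝ᵥ l t) / (t - tb) ^ 2) (𝓝[Set.Ici 0 \ {tb}] tb)
        (𝓝 (b ⬝ᵥ (Aᵀ * Aᵀ) *ᵥ l tb)) ∧
      b ⬝ᵥ (Aᵀ * Aᵀ) *ᵥ l tb ≠ 0 ∧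
      ∃ ε > (0:ℝ), ∀ s, 0 ≤ s → s ≠ tb → |s - tb| < ε →
        0 < (b ⬝ᵥ (Aᵀ * Aᵀ) *ᵥ l tb) * (b ⬝ᵥ l s) := by
    intro hd0
    have hAA : b ⬝ᵥ (Aᵀ * Aᵀ) *ᵥ l tb = (A *ᵥ b) ⬝ᵥ Aᵀ *ᵥ l tb := by
      rw [← mulVec_mulVec, hAT]
    have hg0 : (A *ᵥ b) ⬝ᵥ l tb = 0 := by rw [← hAT]; linarith
    have hne : b ⬝ᵥ (Aᵀ * Aᵀ) *ᵥ l tb ≠ 0 := by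
      intro h0
      refine hltb (eq_zero_of_dotProduct_eq_zero hctrl fun i => ?_)
      rw [hAA, hAT] at h0
      fin_cases i
      · exact hzero
      · exact hg0
      · exact h0
    set κ := b ⬝ᵥ (Aᵀ * Aᵀ) *ᵥ l tb with hκ
    have hg := hder (A *ᵥ b)
    rw [← hAA, hasDerivWithinAt_iff_isLittleO] at hg
    have hb' := hb
    rw [hd0, hasDerivWithinAt_iff_isLittleO] at hb'
    have hφo : (fun s => b ⬝ᵥ L s) =o[𝓝[Set.Ici 0] tb] fun s => s - tb := by
      refine hb'.congr' ?_ EventuallyEq.rfl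
      filter_upwards [self_mem_nhdsWithin] with t ht
      simp [hzero, hLl t ht]
    have h := isLittleO_integral_sub_pow (p := fun s => b ⬝ᵥ f s) (κ := -κ)
      Set.ordConnected_Ici htb 1 (fun t _ => hdoti b t) (by
        simp only [pow_one]
        refine (hg.add ((huφ hφo).const_mul_left (b ⬝ᵥ c))).congr' ?_ EventuallyEq.rfl
        filter_upwards [self_mem_nhdsWithin] with t ht
        rw [hvf, hAT, hg0, hLl t ht, smul_eq_mul]; ring)
    have hlim : Tendsto (fun t => 2 * (b ⬝ᵥ l t) / (t - tb) ^ 2) (𝓝[Set.Ici 0 \ {tb}] tb)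
        (𝓝 κ) := by
      have h2 := (h.mono
        (nhdsWithin_mono tb (Set.sdiff_subset (t := {tb})))).tendsto_div_nhds_zero
      have h3 := (h2.const_mul (-2)).const_add κ
      rw [mul_zero, add_zero] at h3
      refine h3.congr' ?_
      filter_upwards [self_mem_nhdsWithin] with t ht
      have hne' : t - tb ≠ 0 := sub_ne_zero.2 ht.2
      rw [hdot b t ht.1, hzero]
      push_cast
      field_simp
      ring
    refine ⟨hlim, hne, ?_⟩
    obtain ⟨ε, hε, hpos⟩ := exists_pos_mul_of_tendsto hlim hne
    refine ⟨ε, hε, fun s hs hst hsε => ?_⟩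
    have h1 := hpos s hs hst hsε
    have h2 : 0 < (s - tb) ^ 2 := sq_pos_of_ne_zero (sub_ne_zero.2 hst)
    have h3 : κ * (2 * (b ⬝ᵥ l s) / (s - tb) ^ 2) = κ * (b ⬝ᵥ l s) * (2 / (s - tb) ^ 2) := by ring
    rw [h3] at h1
    exact pos_of_mul_pos_left h1 (by positivity)
  refine ⟨hb, fun hne => ?_, partb, ?_⟩
  · obtain ⟨ε, hε, hpos⟩ := parta hne
    refine ⟨ε, hε, fun s hs h1 h2 => ?_, fun s h1 h2 => ?_⟩
    · have h := hpos s hs h2.ne (abs_lt.2 ⟨by linarith, by linarith⟩)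
      rw [slope_def_field, hzero, sub_zero, ← mul_div_assoc] at h
      exact (div_pos_iff.1 h).elim (fun h' => by linarith [h'.2]) And.left
    · have h := hpos s (htb.trans h1.le) h1.ne' (abs_lt.2 ⟨by linarith, by linarith⟩)
      rw [slope_def_field, hzero, sub_zero, ← mul_div_assoc] at h
      exact (div_pos_iff_of_pos_right (by linarith)).1 h
  · by_cases hd : -(b ⬝ᵥ Aᵀ *ᵥ l tb) = 0
    · obtain ⟨-, -, ε, hε, hpos⟩ := partb hd
      exact ⟨ε, hε, fun s hs hst hsε => right_ne_zero_of_mul (hpos s hs hst hsε).ne'⟩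
    · obtain ⟨ε, hε, hpos⟩ := parta hd
      refine ⟨ε, hε, fun s hs hst hsε h0 => ?_⟩
      have h := hpos s hs hst hsε
      rw [slope_def_field, hzero, h0] at h
      simp at h
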